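/- arXiv:2409.07408 — 4 statements merged into one kernel-verified Lean document; each statement's English description precedes it below -/
import Mathlib

section
/- Let θ ∈ C_K. Then θ(δ) ≠ 0, and for every integer m with 0 ≤ m < n and every positive-root vector α, both m·θ(δ) − θ(α) ≠ 0 and m·θ(δ) + θ(α) ≠ 0. Consequently C_K is disjoint from every hyperplane of the arrangement 𝒜 = {δ^⊥} ∪ {(mδ ± α)^⊥ : α ∈ Φ^+, 0 ≤ m < n}. (This is the hyperplane-avoidance content of Lemma 3.10, which shows C_K is a GIT chamber.) -/
/-- Hyperplane-avoidance content of Lemma 3.10: every `θ ∈ C_K` satisfies `θ(δ) ≠ 0`,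
and for every `0 ≤ m < n` and every positive-root vector `α`, both `m·θ(δ) - θ(α) ≠ 0`
and `m·θ(δ) + θ(α) ≠ 0`; hence `C_K` avoids every hyperplane of the arrangement `𝒜`. -/
theorem CK_avoids_arrangement (r n : ℕ) (hr : 1 ≤ r) (hn : 1 ≤ n)
    (δ : Fin (r + 1) → ℤ) (hδ0 : δ 0 = 1) (hδpos : ∀ i, 1 ≤ δ i)
    (K : Finset (Fin (r + 1))) (hK : (0 : Fin (r + 1)) ∉ K)
    (θ : Fin (r + 1) → ℚ)
    (hθ : θ ∈ {θ : Fin (r + 1) → ℚ |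
        (∀ k ∈ K, 0 < θ k) ∧
        (∀ i, i ≠ 0 → i ∉ K → ((n : ℚ) - 1) * (∑ j, (δ j : ℚ) * θ j) < θ i) ∧
        (∑ k ∈ K, (δ k : ℚ) * θ k) < ∑ i, (δ i : ℚ) * θ i}) :
    (∑ i, (δ i : ℚ) * θ i) ≠ 0 ∧
    ∀ m : ℕ, m < n → ∀ α : Fin (r + 1) → ℤ,
      α ≠ 0 → α 0 = 0 → (∀ i, 0 ≤ α i ∧ α i ≤ δ i) →
      (m : ℚ) * (∑ i, (δ i : ℚ) * θ i) - (∑ i, (α i : ℚ) * θ i) ≠ 0 ∧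
      (m : ℚ) * (∑ i, (δ i : ℚ) * θ i) + (∑ i, (α i : ℚ) * θ i) ≠ 0 := by
  obtain ⟨hθK, hθI, hsum⟩ := hθ
  have hS : 0 < ∑ i, (δ i : ℚ) * θ i := by
    refine lt_of_le_of_lt (Finset.sum_nonneg fun k hk => ?_) hsum
    have hδk : (0 : ℚ) ≤ δ k := by exact_mod_cast zero_le_one.trans (hδpos k)
    exact mul_nonneg hδk (hθK k hk).le
  set S := ∑ i, (δ i : ℚ) * θ i
  have hn' : (0 : ℚ) ≤ (n : ℚ) - 1 := sub_nonneg.mpr (by exact_mod_cast hn)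
  have hθpos : ∀ i, i ≠ 0 → 0 < θ i := fun i hi => by
    by_cases hiK : i ∈ K
    · exact hθK i hiK
    · exact (mul_nonneg hn' hS.le).trans_lt (hθI i hi hiK)
  refine ⟨hS.ne', fun m hm α hα hα0 hαδ => ?_⟩
  have hαnonneg : ∀ i, (0 : ℚ) ≤ α i := fun i => by exact_mod_cast (hαδ i).1
  have hterm : ∀ i, 0 ≤ (α i : ℚ) * θ i := fun i => by
    rcases eq_or_ne i 0 with rfl | hi
    · simp [hα0]
    · exact mul_nonneg (hαnonneg i) (hθpos i hi).le
  have hle : ∀ i, α i ≠ 0 → θ i ≤ ∑ j, (α j : ℚ) * θ j := fun i hi => by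
    have hi0 : i ≠ 0 := fun h => hi (h ▸ hα0)
    have hone : (1 : ℚ) ≤ α i := by exact_mod_cast (hαδ i).1.lt_of_ne' hi
    exact (le_mul_of_one_le_left (hθpos i hi0).le hone).trans
      (Finset.single_le_sum (fun j _ => hterm j) (Finset.mem_univ i))
  have hαpos : 0 < ∑ j, (α j : ℚ) * θ j := by
    obtain ⟨i, hi⟩ := Function.ne_iff.mp hα
    exact (hθpos i fun h => hi (h ▸ hα0)).trans_le (hle i hi)
  refine ⟨?_, (add_pos_of_nonneg_of_pos (mul_nonneg m.cast_nonneg hS.le) hαpos).ne'⟩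
  by_cases hsupp : ∀ i, i ∉ K → α i = 0
  · rcases m.eq_zero_or_pos with rfl | hm0
    · simpa using hαpos.ne'
    have hαS : ∑ j, (α j : ℚ) * θ j < S := by
      refine lt_of_le_of_lt ?_ hsum
      rw [← Finset.sum_subset K.subset_univ fun i _ hi => by simp [hsupp i hi]]
      refine Finset.sum_le_sum fun k hk => mul_le_mul_of_nonneg_right ?_ (hθK k hk).le
      exact_mod_cast (hαδ k).2
    have hmS : S ≤ m * S := le_mul_of_one_le_left hS.le (by exact_mod_cast hm0)
    exact (sub_pos.mpr (hαS.trans_le hmS)).ne'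
  · push Not at hsupp
    obtain ⟨i, hiK, hi⟩ := hsupp
    have hmn : (m : ℚ) ≤ (n : ℚ) - 1 := le_sub_iff_add_le.mpr (by exact_mod_cast hm)
    exact (sub_neg.mpr (((mul_le_mul_of_nonneg_right hmn hS.le).trans_lt
      (hθI i (fun h => hi (h ▸ hα0)) hiK)).trans_le (hle i hi))).ne
end

section
/- Let θ ∈ F satisfy θ(δ) ≠ 0, and suppose that for every integer m with 0 ≤ m < n and every positive-root vector α one has m·θ(δ) − θ(α) ≠ 0 and, in addition, (m·θ(δ) − θ(α))·(m·η(δ) − η(α)) ≥ 0 for every η ∈ σ_K. Then θ ∈ C_K. (This is the arrangement-level form of the uniqueness argument in the proof of Theorem 1.1: C_K is the unique chamber of the hyperplane arrangement 𝒜 inside F whose closure contains σ_K.) -/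
/-- If `δ 0 = 1`, a parameter may be prescribed freely away from `0` together with its value on
`δ`. -/
theorem exists_parameter_eq_of_ne_zero {r : ℕ} (δ : Fin (r + 1) → ℤ) (hδ0 : δ 0 = 1)
    (f : Fin (r + 1) → ℚ) (c : ℚ) :
    ∃ η : Fin (r + 1) → ℚ, (∀ i, i ≠ 0 → η i = f i) ∧ ∑ i, (δ i : ℚ) * η i = c := by
  refine ⟨Function.update f 0 (c - ∑ i : Fin r, (δ i.succ : ℚ) * f i.succ),
    fun i hi => Function.update_of_ne hi _ _, ?_⟩
  simp [Fin.sum_univ_succ, hδ0]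


/-- Arrangement-level form of the uniqueness argument in the proof of Theorem 1.1:
a parameter `θ ∈ F` with `θ(δ) ≠ 0` that lies on no hyperplane of the arrangement `𝒜`
and lies on the same (weak) side as `σ_K` of every hyperplane `(mδ - α)^⊥` must belong
to the chamber `C_K`. -/
theorem unique_chamber_containing_sigmaK (r n : ℕ) (hr : 1 ≤ r) (hn : 2 ≤ n)
    (δ : Fin (r + 1) → ℤ) (hδ0 : δ 0 = 1) (hδpos : ∀ i, 1 ≤ δ i)
    (K : Finset (Fin (r + 1))) (hK : (0 : Fin (r + 1)) ∉ K)
    (θ : Fin (r + 1) → ℚ)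
    (hθF : θ ∈ {θ : Fin (r + 1) → ℚ |
        0 ≤ (∑ i, (δ i : ℚ) * θ i) ∧ ∀ i, i ≠ 0 → 0 ≤ θ i})
    (hθδ : (∑ i, (δ i : ℚ) * θ i) ≠ 0)
    (hθ : ∀ m : ℕ, m < n → ∀ α : Fin (r + 1) → ℤ,
      α ≠ 0 → α 0 = 0 → (∀ i, 0 ≤ α i ∧ α i ≤ δ i) →
      ((m : ℚ) * (∑ i, (δ i : ℚ) * θ i) - (∑ i, (α i : ℚ) * θ i) ≠ 0 ∧
       ∀ η ∈ {η : Fin (r + 1) → ℚ |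
          0 ≤ (∑ i, (δ i : ℚ) * η i) ∧ (∀ k ∈ K, η k = 0) ∧
          ∀ i, i ≠ 0 → i ∉ K → ((n : ℚ) - 1) * (∑ j, (δ j : ℚ) * η j) ≤ η i},
        0 ≤ ((m : ℚ) * (∑ i, (δ i : ℚ) * θ i) - (∑ i, (α i : ℚ) * θ i)) *
            ((m : ℚ) * (∑ i, (δ i : ℚ) * η i) - (∑ i, (α i : ℚ) * η i)))) :
    θ ∈ {θ : Fin (r + 1) → ℚ |
        (∀ k ∈ K, 0 < θ k) ∧
        (∀ i, i ≠ 0 → i ∉ K → ((n : ℚ) - 1) * (∑ j, (δ j : ℚ) * θ j) < θ i) ∧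
        (∑ k ∈ K, (δ k : ℚ) * θ k) < ∑ i, (δ i : ℚ) * θ i} := by
  obtain ⟨hθ_nonneg, hθi⟩ := hθF
  have hpos : 0 < ∑ i, (δ i : ℚ) * θ i := lt_of_le_of_ne hθ_nonneg (Ne.symm hθδ)
  have hsingle_ne (i : Fin (r + 1)) : (Pi.single i 1 : Fin (r + 1) → ℤ) ≠ 0 := by simp
  have hsingle_zero (i : Fin (r + 1)) (hi : i ≠ 0) :
      (Pi.single i 1 : Fin (r + 1) → ℤ) 0 = 0 := Pi.single_eq_of_ne hi.symm _
  have hsingle_le (i j : Fin (r + 1)) :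
      0 ≤ (Pi.single i 1 : Fin (r + 1) → ℤ) j ∧
        (Pi.single i 1 : Fin (r + 1) → ℤ) j ≤ δ j := by
    have := hδpos j
    rw [Pi.single_apply]
    split_ifs <;> omega
  have hsingle_sum (i : Fin (r + 1)) (η : Fin (r + 1) → ℚ) :
      ∑ j, ((Pi.single i 1 : Fin (r + 1) → ℤ) j : ℚ) * η j = η i := by
    simp [Pi.single_apply]
  have hKzero : ∀ k ∈ K, k ≠ 0 := fun k hk h => hK (h ▸ hk)
  refine ⟨fun k hk => ?_, fun i hi hiK => ?_, ?_⟩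
  · have hne := (hθ 0 (by omega) _ (hsingle_ne k) (hsingle_zero k (hKzero k hk))
      (hsingle_le k)).1
    rw [hsingle_sum] at hne
    refine lt_of_le_of_ne (hθi k (hKzero k hk)) fun h => hne ?_
    simp [← h]
  · obtain ⟨hne, hside⟩ := hθ (n - 1) (by omega) _ (hsingle_ne i) (hsingle_zero i hi)
      (hsingle_le i)
    obtain ⟨η, hη, hηδ⟩ := exists_parameter_eq_of_ne_zero δ hδ0 (Pi.single i 1) 0
    have hηi : η i = 1 := by simp [hη i hi]
    have h := hside η ⟨hηδ.ge, fun k hk => ?_, fun j hj _ => ?_⟩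
    · rw [hsingle_sum, hsingle_sum, hηδ, hηi] at h
      rw [hsingle_sum] at hne
      rw [Nat.cast_sub (by omega), Nat.cast_one] at h hne
      refine lt_of_le_of_ne ?_ (sub_ne_zero.mp hne)
      linarith
    · rw [hη k (hKzero k hk)]
      exact Pi.single_eq_of_ne (ne_of_mem_of_not_mem hk hiK) _
    · rw [hηδ, mul_zero, hη j hj, Pi.single_apply]
      split_ifs <;> norm_num
  · rcases K.eq_empty_or_nonempty with rfl | ⟨k, hk⟩
    · simpa using hpos
    have hα_sum (η : Fin (r + 1) → ℚ) :
        ∑ i, ((if i ∈ K then δ i else 0 : ℤ) : ℚ) * η i = ∑ i ∈ K, (δ i : ℚ) * η i := by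
      simp [ite_mul, Finset.sum_ite_mem]
    obtain ⟨hne, hside⟩ := hθ 1 (by omega) (fun i => if i ∈ K then δ i else 0)
      (fun h => by
        have h1 := congrFun h k
        have h2 := hδpos k
        simp only [hk, if_true, Pi.zero_apply] at h1
        omega)
      (by simp [hK])
      (fun i => by
        have := hδpos i
        split_ifs <;> omega)
    obtain ⟨η, hη, hηδ⟩ := exists_parameter_eq_of_ne_zero δ hδ0
      (fun i => if i ∈ K then 0 else (n : ℚ) - 1) 1
    have hηK : ∀ j ∈ K, η j = 0 := fun j hj => by simp [hη j (hKzero j hj), hj]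
    have h := hside η ⟨by rw [hηδ]; exact zero_le_one, hηK, fun j hj hjK => by
      simp [hη j hj, hjK, hηδ]⟩
    have hηα : ∑ i ∈ K, (δ i : ℚ) * η i = 0 :=
      Finset.sum_eq_zero fun j hj => by rw [hηK j hj, mul_zero]
    rw [hα_sum, hα_sum, hηα, hηδ] at h
    rw [hα_sum] at hne
    rw [Nat.cast_one, one_mul] at h hne
    refine lt_of_le_of_ne ?_ (sub_ne_zero.mp hne).symm
    linarith
end

section
/- σ_K ⊆ F', σ_K' ⊆ F', and the ℚ-linear span of F' has dimension r − |K| + 1. Moreover, for every subset J ⊆ I, if the face F_J := F ∩ {θ : θ_j = 0 for all j ∈ J} of F contains σ_K' and the ℚ-linear span of F_J has dimension r − |K| + 1, then J = K and F_J = F'. Thus F' is the unique face of F of dimension r − |K| + 1 that contains σ_K' and is not contained in the hyperplane δ^⊥. (This is the uniqueness of the face F' established in the proof of Theorem 1.1.) -/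
/-- A set of vectors that vanish on `K` and that contains the standard basis vectors indexed by the
complement of `K` spans a space of dimension `|Kᶜ|`. -/
theorem finrank_span_of_vanish_of_single_mem {ι k : Type*} [Fintype ι] [DecidableEq ι] [Field k]
    (K : Finset ι) (S : Set (ι → k)) (hvanish : ∀ θ ∈ S, ∀ i ∈ K, θ i = 0)
    (hsingle : ∀ i ∉ K, Pi.single i 1 ∈ S) :
    Module.finrank k (Submodule.span k S) = Fintype.card ι - K.card := by
  have hspan : Submodule.span k S =
      Submodule.span k (Set.range fun i : {i // i ∉ K} ↦ (Pi.single i.1 1 : ι → k)) := by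
    apply le_antisymm
    · rw [Submodule.span_le]
      intro θ hθ
      rw [SetLike.mem_coe, pi_eq_sum_univ' θ]
      refine Submodule.sum_mem _ fun i _ ↦ ?_
      by_cases hi : i ∈ K
      · simp [hvanish θ hθ i hi]
      · refine Submodule.smul_mem _ _ (Submodule.subset_span ⟨⟨i, hi⟩, ?_⟩)
        ext j
        simp [Pi.single_apply]
    · apply Submodule.span_mono
      rintro _ ⟨i, rfl⟩
      exact hsingle i i.2
  have hindep : LinearIndependent k fun i : {i // i ∉ K} ↦ (Pi.single i.1 1 : ι → k) := by
    simpa [Function.comp_def] using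
      (Pi.basisFun k ι).linearIndependent.comp (Subtype.val : {i // i ∉ K} → ι)
        Subtype.val_injective
  rw [hspan, finrank_span_eq_card hindep, Fintype.card_subtype_compl]
  simp

/-- The standard basis vectors pair nonnegatively with a vector of nonnegative integers. -/
theorem sum_mul_single_nonneg {ι : Type*} [Fintype ι] [DecidableEq ι] {δ : ι → ℤ}
    (hδ : ∀ i, 0 ≤ δ i) (i : ι) :
    0 ≤ ∑ j, (δ j : ℚ) * (Pi.single i 1 : ι → ℚ) j := by
  simpa [Pi.single_apply] using hδ i


/-- Uniqueness of the face `F'` established in the proof of Theorem 1.1: `σ_K` and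
`σ_K'` lie in `F'`, the span of `F'` has dimension `r - |K| + 1`, and `F'` is the only
face `F_J = F ∩ {θ_j = 0, j ∈ J}` of `F` of that dimension containing `σ_K'`. -/
theorem unique_face_F' (r n : ℕ) (hr : 1 ≤ r) (hn : 1 ≤ n)
    (δ : Fin (r + 1) → ℤ) (hδ0 : δ 0 = 1) (hδpos : ∀ i, 1 ≤ δ i)
    (K : Finset (Fin (r + 1))) (hK : (0 : Fin (r + 1)) ∉ K) :
    {θ : Fin (r + 1) → ℚ |
        0 ≤ (∑ i, (δ i : ℚ) * θ i) ∧ (∀ k ∈ K, θ k = 0) ∧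
        ∀ i, i ≠ 0 → i ∉ K → ((n : ℚ) - 1) * (∑ j, (δ j : ℚ) * θ j) ≤ θ i} ⊆
      {θ : Fin (r + 1) → ℚ |
        0 ≤ (∑ i, (δ i : ℚ) * θ i) ∧ (∀ k ∈ K, θ k = 0) ∧
        ∀ i, i ≠ 0 → i ∉ K → 0 ≤ θ i} ∧
    {θ : Fin (r + 1) → ℚ |
        (∑ i, (δ i : ℚ) * θ i) = 0 ∧ (∀ k ∈ K, θ k = 0) ∧
        ∀ i, i ≠ 0 → i ∉ K → 0 ≤ θ i} ⊆
      {θ : Fin (r + 1) → ℚ |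
        0 ≤ (∑ i, (δ i : ℚ) * θ i) ∧ (∀ k ∈ K, θ k = 0) ∧
        ∀ i, i ≠ 0 → i ∉ K → 0 ≤ θ i} ∧
    Module.finrank ℚ ↥(Submodule.span ℚ
      {θ : Fin (r + 1) → ℚ |
        0 ≤ (∑ i, (δ i : ℚ) * θ i) ∧ (∀ k ∈ K, θ k = 0) ∧
        ∀ i, i ≠ 0 → i ∉ K → 0 ≤ θ i}) = r - K.card + 1 ∧
    ∀ J : Finset (Fin (r + 1)), (0 : Fin (r + 1)) ∉ J →
      ({θ : Fin (r + 1) → ℚ |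
          (∑ i, (δ i : ℚ) * θ i) = 0 ∧ (∀ k ∈ K, θ k = 0) ∧
          ∀ i, i ≠ 0 → i ∉ K → 0 ≤ θ i} ⊆
        ({θ : Fin (r + 1) → ℚ |
            0 ≤ (∑ i, (δ i : ℚ) * θ i) ∧ ∀ i, i ≠ 0 → 0 ≤ θ i} ∩
          {θ : Fin (r + 1) → ℚ | ∀ j ∈ J, θ j = 0})) →
      Module.finrank ℚ ↥(Submodule.span ℚ
        (({θ : Fin (r + 1) → ℚ |
            0 ≤ (∑ i, (δ i : ℚ) * θ i) ∧ ∀ i, i ≠ 0 → 0 ≤ θ i} ∩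
          {θ : Fin (r + 1) → ℚ | ∀ j ∈ J, θ j = 0}))) = r - K.card + 1 →
      J = K ∧
        (({θ : Fin (r + 1) → ℚ |
            0 ≤ (∑ i, (δ i : ℚ) * θ i) ∧ ∀ i, i ≠ 0 → 0 ≤ θ i} ∩
          {θ : Fin (r + 1) → ℚ | ∀ j ∈ J, θ j = 0})) =
          {θ : Fin (r + 1) → ℚ |
            0 ≤ (∑ i, (δ i : ℚ) * θ i) ∧ (∀ k ∈ K, θ k = 0) ∧
            ∀ i, i ≠ 0 → i ∉ K → 0 ≤ θ i} := by
  have hcard : K.card ≤ r := by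
    simpa using Finset.card_lt_univ_of_notMem hK
  have hδ : ∀ i, 0 ≤ δ i := fun i ↦ zero_le_one.trans (hδpos i)
  have hsingle (i j : Fin (r + 1)) : 0 ≤ (Pi.single i 1 : Fin (r + 1) → ℚ) j := by
    rw [Pi.single_apply]
    split_ifs <;> norm_num
  have hn' : (0 : ℚ) ≤ n - 1 := sub_nonneg.2 (by exact_mod_cast hn)
  refine ⟨?_, ?_, ?_, ?_⟩
  · rintro θ ⟨h, hθK, hθ⟩
    exact ⟨h, hθK, fun i h0 hi ↦ (mul_nonneg hn' h).trans (hθ i h0 hi)⟩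
  · rintro θ ⟨h, hθ⟩
    exact ⟨h.ge, hθ⟩
  · rw [finrank_span_of_vanish_of_single_mem K _ fun θ hθ ↦ hθ.2.1, Fintype.card_fin]
    · lia
    · intro i hi
      exact ⟨sum_mul_single_nonneg hδ i,
        fun k hk ↦ Pi.single_eq_of_ne (ne_of_mem_of_not_mem hk hi) _, fun j _ _ ↦ hsingle i j⟩
  · intro J hJ hsub hdim
    rw [finrank_span_of_vanish_of_single_mem J _ fun θ hθ ↦ hθ.2, Fintype.card_fin] at hdim
    swap
    · intro i hi
      exact ⟨⟨sum_mul_single_nonneg hδ i, fun j _ ↦ hsingle i j⟩,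
        fun j hj ↦ Pi.single_eq_of_ne (ne_of_mem_of_not_mem hj hi) _⟩
    have hJK : J ⊆ K := by
      intro j hj
      by_contra hjK
      have hj0 : j ≠ 0 := ne_of_mem_of_not_mem hj hJ
      let θ : Fin (r + 1) → ℚ := Pi.single j 1 - Pi.single 0 (δ j : ℚ)
      have hθ (i : Fin (r + 1)) (hi : i ≠ 0) : θ i = (Pi.single j 1 : Fin (r + 1) → ℚ) i := by
        simp [θ, hi]
      have hθJ : θ j = 0 := by
        refine (hsub ⟨?_, fun k hk ↦ ?_, fun i hi _ ↦ ?_⟩).2 j hj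
        · simp [θ, mul_sub, Pi.single_apply, hδ0]
        · rw [hθ k (ne_of_mem_of_not_mem hk hK)]
          exact Pi.single_eq_of_ne (ne_of_mem_of_not_mem hk hjK) _
        · rw [hθ i hi]
          exact hsingle j i
      rw [hθ j hj0, Pi.single_eq_same] at hθJ
      exact one_ne_zero hθJ
    obtain rfl : J = K := Finset.eq_of_subset_of_card_le hJK (by lia)
    refine ⟨rfl, Set.ext fun θ ↦ ⟨?_, ?_⟩⟩
    · rintro ⟨⟨h, hθ⟩, hθJ⟩
      exact ⟨h, hθJ, fun i hi _ ↦ hθ i hi⟩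
    · rintro ⟨h, hθJ, hθ⟩
      refine ⟨⟨h, fun i hi ↦ ?_⟩, hθJ⟩
      by_cases hiJ : i ∈ J
      · exact (hθJ i hiJ).ge
      · exact hθ i hi hiJ
end

section
/- C̄_K ⊆ F, the set C_K is an open subset of ℚ^{r+1}, and the ℚ-linear span of C̄_K is all of ℚ^{r+1}; in particular C̄_K is a closed cone of full dimension r + 1 contained in F. (This is the conclusion of Lemma 3.10 that the closure of the chamber C_K is a cone of dimension r + 1 lying in F.) -/
/-- A set with nonempty interior spans the whole space. -/
theorem Submodule.span_eq_top_of_nonempty_interior {𝕜 E : Type*} [NontriviallyNormedField 𝕜]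
    [AddCommGroup E] [TopologicalSpace E] [ContinuousAdd E] [Module 𝕜 E] [ContinuousSMul 𝕜 E]
    {s : Set E} (hs : (interior s).Nonempty) : Submodule.span 𝕜 s = ⊤ :=
  Submodule.eq_top_of_nonempty_interior' _ (hs.mono (interior_mono Submodule.subset_span))

/-- The chamber `C_K` is nonempty. -/
theorem exists_mem_chamber {r n : ℕ} {δ : Fin (r + 1) → ℤ} (hδ0 : δ 0 = 1)
    (hδpos : ∀ i, 1 ≤ δ i) {K : Finset (Fin (r + 1))} (hK : (0 : Fin (r + 1)) ∉ K) :
    ∃ θ : Fin (r + 1) → ℚ,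
      (∀ k ∈ K, 0 < θ k) ∧
      (∀ i, i ≠ 0 → i ∉ K → ((n : ℚ) - 1) * (∑ j, (δ j : ℚ) * θ j) < θ i) ∧
      (∑ k ∈ K, (δ k : ℚ) * θ k) < ∑ i, (δ i : ℚ) * θ i := by
  have hS : 0 ≤ ∑ k ∈ K, (δ k : ℚ) :=
    Finset.sum_nonneg fun k _ => by exact_mod_cast zero_le_one.trans (hδpos k)
  set ε : ℚ := 1 / (1 + ∑ k ∈ K, (δ k : ℚ)) with hε
  have hεpos : 0 < ε := by positivity
  let t : Fin r → ℚ := fun i => if i.succ ∈ K then ε else n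
  let θ : Fin (r + 1) → ℚ := Fin.cons (1 - ∑ i : Fin r, (δ i.succ : ℚ) * t i) t
  have htotal : ∑ j, (δ j : ℚ) * θ j = 1 := by
    simp [Fin.sum_univ_succ, θ, hδ0]
  have hθK : ∀ k ∈ K, θ k = ε := by
    intro k hk
    induction k using Fin.cases with
    | zero => exact absurd hk hK
    | succ i => simp [θ, t, hk]
  refine ⟨θ, fun k hk => (hθK k hk).symm ▸ hεpos, fun i hi hiK => ?_, ?_⟩
  · induction i using Fin.cases with
    | zero => exact absurd rfl hi
    | succ i => rw [htotal]; simp [θ, t, hiK]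
  · rw [htotal, Finset.sum_congr rfl fun k hk => by rw [hθK k hk], ← Finset.sum_mul, hε,
      mul_one_div, div_lt_one (by positivity)]
    linarith


/-- Conclusion of Lemma 3.10: `C̄_K ⊆ F`, the chamber `C_K` is open, and the span of
`C̄_K` is all of `ℚ^{r+1}`; i.e. `C̄_K` is a full-dimensional closed cone in `F`. -/
theorem closure_CK_full_dimensional_in_F (r n : ℕ) (hr : 1 ≤ r) (hn : 1 ≤ n)
    (δ : Fin (r + 1) → ℤ) (hδ0 : δ 0 = 1) (hδpos : ∀ i, 1 ≤ δ i)
    (K : Finset (Fin (r + 1))) (hK : (0 : Fin (r + 1)) ∉ K) :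
    {θ : Fin (r + 1) → ℚ |
        (∀ k ∈ K, 0 ≤ θ k) ∧
        (∀ i, i ≠ 0 → i ∉ K → ((n : ℚ) - 1) * (∑ j, (δ j : ℚ) * θ j) ≤ θ i) ∧
        (∑ k ∈ K, (δ k : ℚ) * θ k) ≤ ∑ i, (δ i : ℚ) * θ i} ⊆
      {θ : Fin (r + 1) → ℚ |
        0 ≤ (∑ i, (δ i : ℚ) * θ i) ∧ ∀ i, i ≠ 0 → 0 ≤ θ i} ∧
    IsOpen {θ : Fin (r + 1) → ℚ |
        (∀ k ∈ K, 0 < θ k) ∧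
        (∀ i, i ≠ 0 → i ∉ K → ((n : ℚ) - 1) * (∑ j, (δ j : ℚ) * θ j) < θ i) ∧
        (∑ k ∈ K, (δ k : ℚ) * θ k) < ∑ i, (δ i : ℚ) * θ i} ∧
    Module.finrank ℚ ↥(Submodule.span ℚ
      {θ : Fin (r + 1) → ℚ |
        (∀ k ∈ K, 0 ≤ θ k) ∧
        (∀ i, i ≠ 0 → i ∉ K → ((n : ℚ) - 1) * (∑ j, (δ j : ℚ) * θ j) ≤ θ i) ∧
        (∑ k ∈ K, (δ k : ℚ) * θ k) ≤ ∑ i, (δ i : ℚ) * θ i}) = r + 1 := by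
  have hopen : IsOpen {θ : Fin (r + 1) → ℚ |
        (∀ k ∈ K, 0 < θ k) ∧
        (∀ i, i ≠ 0 → i ∉ K → ((n : ℚ) - 1) * (∑ j, (δ j : ℚ) * θ j) < θ i) ∧
        (∑ k ∈ K, (δ k : ℚ) * θ k) < ∑ i, (δ i : ℚ) * θ i} := by
    simp only [Set.ofPred_and, Set.ofPred_forall]
    refine .inter ?_ (.inter ?_ ?_)
    · exact isOpen_iInter_of_finite fun k => isOpen_iInter_of_finite fun _ =>
        isOpen_lt (by fun_prop) (by fun_prop)
    · exact isOpen_iInter_of_finite fun i => isOpen_iInter_of_finite fun _ =>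
        isOpen_iInter_of_finite fun _ => isOpen_lt (by fun_prop) (by fun_prop)
    · exact isOpen_lt (by fun_prop) (by fun_prop)
  refine ⟨?_, hopen, ?_⟩
  · rintro θ ⟨hθK, hθ, hsum⟩
    have htotal : 0 ≤ ∑ i, (δ i : ℚ) * θ i := hsum.trans' <| Finset.sum_nonneg fun k hk =>
      mul_nonneg (by exact_mod_cast zero_le_one.trans (hδpos k)) (hθK k hk)
    refine ⟨htotal, fun i hi => ?_⟩
    by_cases hiK : i ∈ K
    · exact hθK i hiK
    · exact (mul_nonneg (sub_nonneg.2 (by exact_mod_cast hn)) htotal).trans (hθ i hi hiK)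
  · rw [Submodule.span_eq_top_of_nonempty_interior, finrank_top, Module.finrank_fin_fun]
    obtain ⟨θ, hθ⟩ := exists_mem_chamber (n := n) hδ0 hδpos hK
    refine ⟨θ, interior_maximal ?_ hopen hθ⟩
    exact fun φ hφ => ⟨fun k hk => (hφ.1 k hk).le, fun i hi hiK => (hφ.2.1 i hi hiK).le,
      hφ.2.2.le⟩
end
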